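/- Let w be an edge-weight function assigning distinct nonnegative weights to all potential edges on a finite vertex set V, let G be a graph on V, let F be a minimum spanning forest of G (with respect to w), and let D be any graph on V. Then a subgraph F' of F ∪ D is a minimum spanning forest of F ∪ D if and only if F' is a minimum spanning forest of G ∪ D; in particular, every minimum spanning forest of F ∪ D is a minimum spanning forest of G ∪ D. -/

import Mathlib

/-- The total weight of the edges of a graph `F` under the edge-weight function `w`. -/
noncomputable def totalWeight {V : Type*} (w : Sym2 V → ℝ) (F : SimpleGraph V) : ℝ :=
  ∑ᶠ e ∈ F.edgeSet, w e

/-- `F` is a minimum spanning forest of the weighted graph `G`: a subgraph of `G`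
having the same connected components as `G` and minimum total edge weight among all
such subgraphs. -/
def IsMSF {V : Type*} (w : Sym2 V → ℝ) (G F : SimpleGraph V) : Prop :=
  F ≤ G ∧ (∀ u v : V, F.Reachable u v ↔ G.Reachable u v) ∧
    ∀ F' : SimpleGraph V, F' ≤ G → (∀ u v : V, F'.Reachable u v ↔ G.Reachable u v) →
      totalWeight w F ≤ totalWeight w F'

theorem reach_of_adj {V : Type*} {A B : SimpleGraph V}
    (h : ∀ x y, A.Adj x y → B.Reachable x y) {u v : V} (huv : A.Reachable u v) :
    B.Reachable u v := by
  obtain ⟨p⟩ := huv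
  induction p with
  | nil => exact SimpleGraph.Reachable.refl _
  | cons hadj _ ih => exact (h _ _ hadj).trans ih

/-- The subgraph of edges of weight at most `t`. -/
def lowGraph {V : Type*} (w : Sym2 V → ℝ) (t : ℝ) (H : SimpleGraph V) : SimpleGraph V where
  Adj x y := H.Adj x y ∧ w s(x, y) ≤ t
  symm := ⟨fun x y h => ⟨h.1.symm, by rw [Sym2.eq_swap]; exact h.2⟩⟩
  loopless := ⟨fun x h => H.loopless.irrefl x h.1⟩

theorem totalWeight_delete {V : Type*} [Fintype V] (w : Sym2 V → ℝ) (T : SimpleGraph V)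
    (e : Sym2 V) (he : e ∈ T.edgeSet) :
    totalWeight w T = w e + totalWeight w (T.deleteEdges {e}) := by
  unfold totalWeight
  rw [SimpleGraph.edgeSet_deleteEdges, ← finsum_mem_insert w (by simp) (Set.toFinite _),
    Set.insert_diff_singleton, Set.insert_eq_of_mem he]

theorem msf_low {V : Type*} [Fintype V] (w : Sym2 V → ℝ)
    (G F : SimpleGraph V) (hF : IsMSF w G F) (u v : V) (huv : G.Adj u v) :
    (lowGraph w (w s(u, v)) F).Reachable u v := by
  classical
  by_contra hn
  obtain ⟨hle, hreach, hmin⟩ := hF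
  have hnF : ¬ F.Adj u v := fun h => hn (SimpleGraph.Adj.reachable ⟨h, le_rfl⟩)
  obtain ⟨p, hp⟩ := ((hreach v u).2 huv.symm.reachable).exists_isPath
  obtain ⟨d, hd, h1, h2⟩ := p.exists_boundary_dart
    {x | ¬ (lowGraph w (w s(u, v)) F).Reachable u x} hn
    (fun h => h (SimpleGraph.Reachable.refl _))
  simp only [Set.mem_setOf_eq, not_not] at h1 h2
  have hdw : w s(u, v) < w d.edge := by
    by_contra hlt
    have : (lowGraph w (w s(u, v)) F).Adj d.fst d.snd := ⟨d.adj, not_lt.1 hlt⟩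
    exact h1 (h2.trans this.symm.reachable)
  have hdp : d.edge ∈ p.edges := List.mem_map_of_mem hd
  set E := F ⊔ SimpleGraph.edge u v with hE
  have hFE : F ≤ E := le_sup_left
  have hEG : E ≤ G := by
    refine sup_le hle ?_
    intro x y h
    rw [SimpleGraph.edge_adj] at h
    rcases h with ⟨⟨rfl, rfl⟩ | ⟨rfl, rfl⟩, _⟩
    exacts [huv, huv.symm]
  have hEuv : E.Adj u v := by
    right; rw [SimpleGraph.edge_adj]; exact ⟨Or.inl ⟨rfl, rfl⟩, huv.ne⟩
  have hcyc : (SimpleGraph.Walk.cons hEuv (p.mapLe hFE)).IsCycle := by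
    rw [SimpleGraph.Walk.cons_isCycle_iff]
    refine ⟨hp.mapLe hFE, ?_⟩
    rw [SimpleGraph.Walk.edges_mapLe_eq_edges]
    exact fun h => hnF (p.edges_subset_edgeSet h)
  have hdE : d.edge ∈ E.edgeSet := hFE d.adj
  have hnb : ¬ E.IsBridge d.edge := fun hb =>
    hb.notMem_edges_of_isCycle hcyc (by
      rw [SimpleGraph.Walk.edges_cons, SimpleGraph.Walk.edges_mapLe_eq_edges]
      exact List.mem_cons_of_mem _ hdp)
  have hr : (E.deleteEdges {d.edge}).Reachable d.fst d.snd := by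
    by_contra hh
    exact hnb hh
  have hm := hmin (E.deleteEdges {d.edge}) ((SimpleGraph.deleteEdges_le _).trans hEG) (by
    intro a b
    refine ⟨fun h => h.mono ((SimpleGraph.deleteEdges_le _).trans hEG), fun h => ?_⟩
    refine reach_of_adj ?_ ((hreach a b).2 h)
    intro x y hxy
    by_cases hc : s(x, y) = d.edge
    · rcases Sym2.eq_iff.1 (show s(x, y) = s(d.fst, d.snd) from hc) with ⟨rfl, rfl⟩ | ⟨rfl, rfl⟩
      exacts [hr, hr.symm]
    · refine SimpleGraph.Adj.reachable ?_
      rw [SimpleGraph.deleteEdges_adj]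
      exact ⟨hFE hxy, hc⟩)
  have e1 := totalWeight_delete w E _ hdE
  have e2 := totalWeight_delete w E s(u, v) hEuv
  have e3 : E.deleteEdges {s(u, v)} = F := by
    ext x y
    rw [SimpleGraph.deleteEdges_adj, hE, SimpleGraph.sup_adj, SimpleGraph.adj_edge]
    constructor
    · rintro ⟨h | h, h'⟩
      · exact h
      · exact absurd h.1.symm h'
    · intro h
      refine ⟨Or.inl h, fun h' => hnF ?_⟩
      have : s(x, y) ∈ F.edgeSet := h
      rw [Set.mem_singleton_iff.1 h'] at this
      exact this
  rw [e3] at e2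
  linarith

theorem exists_msf {V : Type*} [Fintype V] (w : Sym2 V → ℝ) (G : SimpleGraph V) :
    ∃ T, IsMSF w G T := by
  obtain ⟨T, hT, hmin⟩ := Set.exists_min_image
    {T : SimpleGraph V | T ≤ G ∧ ∀ u v : V, T.Reachable u v ↔ G.Reachable u v}
    (totalWeight w) (Set.toFinite _) ⟨G, le_rfl, fun _ _ => Iff.rfl⟩
  exact ⟨T, hT.1, hT.2, fun F' h1 h2 => hmin F' ⟨h1, h2⟩⟩

theorem msf_le {V : Type*} [Fintype V] (w : Sym2 V → ℝ)
    (hw0 : ∀ e : Sym2 V, ¬ e.IsDiag → 0 ≤ w e)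
    (hwinj : Set.InjOn w {e : Sym2 V | ¬ e.IsDiag})
    (G F D T : SimpleGraph V) (hF : IsMSF w G F) (hT : IsMSF w (G ⊔ D) T) : T ≤ F ⊔ D := by
  intro u v huv
  by_contra hc
  rw [SimpleGraph.sup_adj, not_or] at hc
  have hG : G.Adj u v := (hT.1 huv).resolve_right hc.2
  have hlow := msf_low w G F hF u v hG
  have key : ∀ x y, (lowGraph w (w s(u, v)) F).Adj x y → w s(x, y) < w s(u, v) := by
    rintro x y ⟨h, h'⟩
    refine lt_of_le_of_ne h' fun heq => hc.1 ?_
    have := hwinj (show ¬ s(x, y).IsDiag from by simpa using h.ne)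
      (show ¬ s(u, v).IsDiag from by simpa using huv.ne) heq
    have h2 : s(x, y) ∈ F.edgeSet := h
    rw [this] at h2
    exact h2
  have hpos : 0 < w s(u, v) := by
    by_contra hn
    have : (⊥ : SimpleGraph V).Reachable u v := reach_of_adj (fun x y h => by
      have h1 := key x y h
      have h2 := hw0 s(x, y) (by simpa using h.ne)
      exact absurd h2 (by linarith)) hlow
    exact huv.ne (SimpleGraph.reachable_bot.1 this)
  have hr : (T.deleteEdges {s(u, v)}).Reachable u v := by
    refine reach_of_adj (fun x y h => ?_) hlow
    have h1 := key x y h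
    refine (msf_low w _ T hT x y (Or.inl (hF.1 h.1))).mono ?_
    rintro a b ⟨hab, hab'⟩
    rw [SimpleGraph.deleteEdges_adj]
    refine ⟨hab, fun h' => ?_⟩
    rw [Set.mem_singleton_iff.1 h'] at hab'
    linarith
  have hm := hT.2.2 (T.deleteEdges {s(u, v)}) ((SimpleGraph.deleteEdges_le _).trans hT.1) (by
    intro a b
    refine ⟨fun h => h.mono ((SimpleGraph.deleteEdges_le _).trans hT.1), fun h => ?_⟩
    refine reach_of_adj ?_ ((hT.2.1 a b).2 h)
    intro x y hxy
    by_cases hc : s(x, y) = s(u, v)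
    · rcases Sym2.eq_iff.1 hc with ⟨rfl, rfl⟩ | ⟨rfl, rfl⟩
      exacts [hr, hr.symm]
    · refine SimpleGraph.Adj.reachable ?_
      rw [SimpleGraph.deleteEdges_adj]
      exact ⟨hxy, hc⟩)
  have := totalWeight_delete w T s(u, v) huv
  linarith

/-- Let `w` assign distinct nonnegative weights to all potential edges on `V`, let
`F` be a minimum spanning forest of `G`, and let `D` be any graph on `V`. Then a
subgraph `F'` of `F ∪ D` is a minimum spanning forest of `F ∪ D` iff it is a minimum
spanning forest of `G ∪ D`; in particular, every minimum spanning forest of `F ∪ D`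
is a minimum spanning forest of `G ∪ D`. -/
theorem stmt_14 {V : Type*} [Fintype V] (w : Sym2 V → ℝ)
    (hw0 : ∀ e : Sym2 V, ¬ e.IsDiag → 0 ≤ w e)
    (hwinj : Set.InjOn w {e : Sym2 V | ¬ e.IsDiag})
    (G F D : SimpleGraph V) (hF : IsMSF w G F) :
    (∀ F' : SimpleGraph V, F' ≤ F ⊔ D →
        (IsMSF w (F ⊔ D) F' ↔ IsMSF w (G ⊔ D) F')) ∧
      (∀ F' : SimpleGraph V, IsMSF w (F ⊔ D) F' → IsMSF w (G ⊔ D) F') := by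
  have hle : F ⊔ D ≤ G ⊔ D := sup_le_sup_right hF.1 D
  have hre : ∀ u v, (F ⊔ D).Reachable u v ↔ (G ⊔ D).Reachable u v := fun u v =>
    ⟨fun h => h.mono hle, reach_of_adj fun x y h => by
      rcases h with h | h
      · exact ((hF.2.1 x y).2 h.reachable).mono le_sup_left
      · exact SimpleGraph.Adj.reachable (Or.inr h)⟩
  have main : ∀ F' : SimpleGraph V, IsMSF w (F ⊔ D) F' → IsMSF w (G ⊔ D) F' := by
    intro F' hF'
    obtain ⟨T, hT⟩ := exists_msf w (G ⊔ D)
    have hTle := msf_le w hw0 hwinj G F D T hF hT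
    refine ⟨hF'.1.trans hle, fun u v => (hF'.2.1 u v).trans (hre u v), fun F'' h1 h2 => ?_⟩
    exact (hF'.2.2 T hTle fun u v => (hT.2.1 u v).trans (hre u v).symm).trans (hT.2.2 F'' h1 h2)
  refine ⟨fun F' hF' => ⟨main F', fun h => ⟨hF', fun u v => (h.2.1 u v).trans (hre u v).symm,
    fun F'' h1 h2 => h.2.2 F'' (h1.trans hle) fun u v => (h2 u v).trans (hre u v)⟩⟩, main⟩
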